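/- Let O be an interval-valued overlap function and let n ≥ 2 be a natural number. Then the functions O^{1/n}(X,Y) = O(X^{1/n}, Y^{1/n}) and Oⁿ(X,Y) = O(Xⁿ, Yⁿ) (where X^{1/n} = [x̲^{1/n}, x̄^{1/n}] and Xⁿ = [x̲ⁿ, x̄ⁿ]) are interval-valued overlap functions, and Oⁿ(X,Y) ≤ O(X,Y) ≤ O^{1/n}(X,Y) for all X, Y, with both inequalities strict at some pair of intervals; consequently, the partially ordered set of interval-valued overlap functions (with pointwise product order) has no least and no greatest element. -/

import Mathlib

/-! Closed subintervals of the unit interval, interval-valued overlap functions,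
and related notions. -/

/-- The set `L([0,1])` of closed subintervals `[lo, hi]` of `[0,1]`. -/
@[ext]
structure IV : Type where
  lo : ℝ
  hi : ℝ
  lo_nonneg : 0 ≤ lo
  lo_le_hi : lo ≤ hi
  hi_le_one : hi ≤ 1

namespace IV

/-- The degenerate interval `[0,0]`. -/
instance : Zero IV := ⟨⟨0, 0, le_refl 0, le_refl 0, zero_le_one⟩⟩

/-- The degenerate interval `[1,1]`. -/
instance : One IV := ⟨⟨1, 1, zero_le_one, le_refl 1, le_refl 1⟩⟩

/-- Interval product: `X * Y = [x̲·y̲, x̄·ȳ]`. -/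
instance : Mul IV :=
  ⟨fun X Y =>
    ⟨X.lo * Y.lo, X.hi * Y.hi, mul_nonneg X.lo_nonneg Y.lo_nonneg,
      mul_le_mul X.lo_le_hi Y.lo_le_hi Y.lo_nonneg (X.lo_nonneg.trans X.lo_le_hi),
      mul_le_one₀ X.hi_le_one (Y.lo_nonneg.trans Y.lo_le_hi) Y.hi_le_one⟩⟩

/-- The product (componentwise) order on intervals. -/
instance : LE IV := ⟨fun X Y => X.lo ≤ Y.lo ∧ X.hi ≤ Y.hi⟩

/-- Componentwise maximum of intervals: `X ∨ Y`. -/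
instance : Max IV :=
  ⟨fun X Y =>
    ⟨max X.lo Y.lo, max X.hi Y.hi, le_max_of_le_left X.lo_nonneg,
      max_le_max X.lo_le_hi Y.lo_le_hi, max_le X.hi_le_one Y.hi_le_one⟩⟩

/-- Componentwise minimum of intervals: `X ∧ Y`. -/
instance : Min IV :=
  ⟨fun X Y =>
    ⟨min X.lo Y.lo, min X.hi Y.hi, le_min X.lo_nonneg Y.lo_nonneg,
      min_le_min X.lo_le_hi Y.lo_le_hi, min_le_of_left_le X.hi_le_one⟩⟩

/-- Interval inclusion: `X ⊆ Y`. -/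
def subs (X Y : IV) : Prop := Y.lo ≤ X.lo ∧ X.hi ≤ Y.hi

/-- The Moore metric on intervals. -/
noncomputable def mdist (X Y : IV) : ℝ := max |X.lo - Y.lo| |X.hi - Y.hi|

/-- Interval power with natural exponent: `Xⁿ = [x̲ⁿ, x̄ⁿ]`. -/
def npow (X : IV) (n : ℕ) : IV :=
  ⟨X.lo ^ n, X.hi ^ n, pow_nonneg X.lo_nonneg n,
    pow_le_pow_left₀ X.lo_nonneg X.lo_le_hi n,
    pow_le_one₀ (X.lo_nonneg.trans X.lo_le_hi) X.hi_le_one⟩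

/-- Interval `n`-th root: `X^{1/n} = [x̲^{1/n}, x̄^{1/n}]`. -/
noncomputable def nroot (X : IV) (n : ℕ) : IV :=
  ⟨X.lo ^ ((n : ℝ))⁻¹, X.hi ^ ((n : ℝ))⁻¹,
    Real.rpow_nonneg X.lo_nonneg _,
    Real.rpow_le_rpow X.lo_nonneg X.lo_le_hi (by positivity),
    Real.rpow_le_one (X.lo_nonneg.trans X.lo_le_hi) X.hi_le_one (by positivity)⟩

/-- Interval complement: `Xᶜ = [1 - x̄, 1 - x̲]`. -/
def compl (X : IV) : IV :=
  ⟨1 - X.hi, 1 - X.lo, by linarith [X.hi_le_one], by linarith [X.lo_le_hi],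
    by linarith [X.lo_nonneg]⟩

/-- Interval power with interval exponent `K = [k₁,k₂]`, `0 < k₁ ≤ k₂`:
`X^K = [x̲^{k₂}, x̄^{k₁}]`. -/
noncomputable def ipow (X : IV) (k₁ k₂ : ℝ) (hk₁ : 0 < k₁) (hk : k₁ ≤ k₂) : IV :=
  ⟨X.lo ^ k₂, X.hi ^ k₁,
    Real.rpow_nonneg X.lo_nonneg _,
    by
      rcases eq_or_lt_of_le X.lo_nonneg with h | h
      · rw [← h, Real.zero_rpow (by linarith : k₂ ≠ 0)]
        exact Real.rpow_nonneg (X.lo_nonneg.trans X.lo_le_hi) _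
      · calc X.lo ^ k₂ ≤ X.lo ^ k₁ :=
              Real.rpow_le_rpow_of_exponent_ge h (X.lo_le_hi.trans X.hi_le_one) hk
          _ ≤ X.hi ^ k₁ := Real.rpow_le_rpow X.lo_nonneg X.lo_le_hi hk₁.le,
    Real.rpow_le_one (X.lo_nonneg.trans X.lo_le_hi) X.hi_le_one hk₁.le⟩

end IV

/-- The unit interval `[0,1]` of real numbers. -/
abbrev I01 := unitInterval

/-- The degenerate interval `[x,x]`. -/
def IV.diag (x : I01) : IV := ⟨x, x, x.2.1, le_refl _, x.2.2⟩

/-- The left endpoint, as an element of `[0,1]`. -/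
def IV.loI (X : IV) : I01 := ⟨X.lo, X.lo_nonneg, X.lo_le_hi.trans X.hi_le_one⟩

/-- The right endpoint, as an element of `[0,1]`. -/
def IV.hiI (X : IV) : I01 := ⟨X.hi, X.lo_nonneg.trans X.lo_le_hi, X.hi_le_one⟩

/-- Moore continuity of a unary interval function. -/
def MooreCont1 (g : IV → IV) : Prop :=
  ∀ X : IV, ∀ ε > (0 : ℝ), ∃ δ > (0 : ℝ), ∀ Y : IV,
    IV.mdist X Y < δ → IV.mdist (g X) (g Y) < ε

/-- Moore continuity of a binary interval function. -/
def MooreCont2 (O : IV → IV → IV) : Prop :=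
  ∀ X Y : IV, ∀ ε > (0 : ℝ), ∃ δ > (0 : ℝ), ∀ X' Y' : IV,
    IV.mdist X X' < δ → IV.mdist Y Y' < δ → IV.mdist (O X Y) (O X' Y') < ε

/-- Interval-valued overlap function. -/
structure IVOverlap (O : IV → IV → IV) : Prop where
  comm : ∀ X Y, O X Y = O Y X
  zero_iff : ∀ X Y, O X Y = 0 ↔ X * Y = 0
  one_iff : ∀ X Y, O X Y = 1 ↔ X * Y = 1
  mono : ∀ X Y Z, Y ≤ Z → O X Y ≤ O X Z
  cont : MooreCont2 O

/-- Migrativity of a binary interval function. -/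
def Migrative (F : IV → IV → IV) : Prop := ∀ α X Y : IV, F (α * X) Y = F X (α * Y)

/-- (Real-valued) overlap function on `[0,1]`. -/
structure Overlap (G : I01 → I01 → I01) : Prop where
  comm : ∀ x y, G x y = G y x
  zero_iff : ∀ x y, G x y = 0 ↔ x * y = 0
  one_iff : ∀ x y, G x y = 1 ↔ x * y = 1
  mono : ∀ x y z, y ≤ z → G x y ≤ G x z
  cont : Continuous (Function.uncurry G)

/-- Left projection of a binary interval function. -/
def lproj (O : IV → IV → IV) (x y : I01) : I01 := (O (IV.diag x) (IV.diag y)).loI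

/-- Right projection of a binary interval function. -/
def rproj (O : IV → IV → IV) (x y : I01) : I01 := (O (IV.diag x) (IV.diag y)).hiI

/-- `O(X,Y) = [G₁(x̲,y̲), G₂(x̄,ȳ)]` for all `X, Y`. -/
def Represents (G₁ G₂ : I01 → I01 → I01) (O : IV → IV → IV) : Prop :=
  ∀ X Y : IV, (O X Y).lo = (G₁ X.loI Y.loI : ℝ) ∧ (O X Y).hi = (G₂ X.hiI Y.hiI : ℝ)

/-- o-representability of an interval-valued overlap function. -/
def ORepresentable (O : IV → IV → IV) : Prop :=
  ∃ G₁ G₂ : I01 → I01 → I01, Overlap G₁ ∧ Overlap G₂ ∧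
    (∀ x y, G₁ x y ≤ G₂ x y) ∧ Represents G₁ G₂ O

/-- Interval-valued t-norm. -/
structure IVTnorm (T : IV → IV → IV) : Prop where
  comm : ∀ X Y, T X Y = T Y X
  assoc : ∀ X Y Z, T X (T Y Z) = T (T X Y) Z
  mono : ∀ X Y Z, Y ≤ Z → T X Y ≤ T X Z
  one : ∀ X, T X 1 = X

namespace IV

theorem mul_eq_zero_iff (X Y : IV) : X * Y = 0 ↔ X.hi * Y.hi = 0 := by
  constructor
  · intro h
    exact congrArg IV.hi h
  · intro h
    refine IV.ext (le_antisymm ?_ (X * Y).lo_nonneg) h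
    exact (X * Y).lo_le_hi.trans h.le

theorem mul_eq_one_iff (X Y : IV) : X * Y = 1 ↔ X.lo * Y.lo = 1 := by
  constructor
  · intro h
    exact congrArg IV.lo h
  · intro h
    refine IV.ext h (le_antisymm (X * Y).hi_le_one ?_)
    exact h.symm.le.trans (X * Y).lo_le_hi

theorem hi_nonneg (X : IV) : 0 ≤ X.hi := X.lo_nonneg.trans X.lo_le_hi

theorem lo_le_one (X : IV) : X.lo ≤ 1 := X.lo_le_hi.trans X.hi_le_one

theorem le_trans' {X Y Z : IV} (h₁ : X ≤ Y) (h₂ : Y ≤ Z) : X ≤ Z :=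
  ⟨h₁.1.trans h₂.1, h₁.2.trans h₂.2⟩

theorem le_antisymm' {X Y : IV} (h₁ : X ≤ Y) (h₂ : Y ≤ X) : X = Y :=
  IV.ext (le_antisymm h₁.1 h₂.1) (le_antisymm h₁.2 h₂.2)

theorem nroot_npow (X : IV) {n : ℕ} (hn : n ≠ 0) : (X.npow n).nroot n = X :=
  IV.ext (Real.pow_rpow_inv_natCast X.lo_nonneg hn) (Real.pow_rpow_inv_natCast X.hi_nonneg hn)

theorem npow_npow (X : IV) (m n : ℕ) : (X.npow m).npow n = X.npow (m * n) :=
  IV.ext (pow_mul _ _ _).symm (pow_mul _ _ _).symm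

theorem npow_le_self (X : IV) {n : ℕ} (hn : n ≠ 0) : X.npow n ≤ X :=
  ⟨pow_le_of_le_one X.lo_nonneg X.lo_le_one hn, pow_le_of_le_one X.hi_nonneg X.hi_le_one hn⟩

theorem self_le_nroot (X : IV) {n : ℕ} (hn : n ≠ 0) : X ≤ X.nroot n := by
  have hp : ((n : ℝ))⁻¹ ≤ 1 := inv_le_one_of_one_le₀ (by exact_mod_cast Nat.one_le_iff_ne_zero.2 hn)
  exact ⟨Real.self_le_rpow_of_le_one X.lo_nonneg X.lo_le_one hp,
    Real.self_le_rpow_of_le_one X.hi_nonneg X.hi_le_one hp⟩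

end IV

theorem mooreCont1_of_continuous {f : ℝ → ℝ} (hf : Continuous f) {φ : IV → IV}
    (hlo : ∀ X, (φ X).lo = f X.lo) (hhi : ∀ X, (φ X).hi = f X.hi) : MooreCont1 φ := by
  intro X ε hε
  obtain ⟨δ₁, hδ₁, h₁⟩ := Metric.continuous_iff'.1 hf X.lo ε hε |> Metric.eventually_nhds_iff.1
  obtain ⟨δ₂, hδ₂, h₂⟩ := Metric.continuous_iff'.1 hf X.hi ε hε |> Metric.eventually_nhds_iff.1
  refine ⟨min δ₁ δ₂, lt_min hδ₁ hδ₂, fun Y hY => ?_⟩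
  obtain ⟨hY₁, hY₂⟩ := max_lt_iff.1 hY
  rw [abs_sub_comm] at hY₁ hY₂
  refine max_lt ?_ ?_
  · rw [hlo, hlo, abs_sub_comm]
    exact h₁ (hY₁.trans_le (min_le_left _ _))
  · rw [hhi, hhi, abs_sub_comm]
    exact h₂ (hY₂.trans_le (min_le_right _ _))

namespace IVOverlap

variable {O : IV → IV → IV}

theorem mono₂ (hO : IVOverlap O) {X X' Y Y' : IV} (hX : X ≤ X') (hY : Y ≤ Y') :
    O X Y ≤ O X' Y' := by
  refine IV.le_trans' (hO.mono X Y Y' hY) ?_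
  rw [hO.comm X, hO.comm X']
  exact hO.mono Y' X X' hX

/-- Precomposing an overlap function with a map acting on both endpoints as `t ↦ t ^ p`,
`p > 0`, gives an overlap function. -/
theorem comp_rpow (hO : IVOverlap O) {p : ℝ} (hp : 0 < p) {φ : IV → IV}
    (hlo : ∀ X, (φ X).lo = X.lo ^ p) (hhi : ∀ X, (φ X).hi = X.hi ^ p) :
    IVOverlap (fun X Y => O (φ X) (φ Y)) where
  comm X Y := hO.comm _ _
  zero_iff X Y := by
    rw [hO.zero_iff, IV.mul_eq_zero_iff, IV.mul_eq_zero_iff, hhi, hhi,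
      ← Real.mul_rpow X.hi_nonneg Y.hi_nonneg,
      Real.rpow_eq_zero (mul_nonneg X.hi_nonneg Y.hi_nonneg) hp.ne']
  one_iff X Y := by
    rw [hO.one_iff, IV.mul_eq_one_iff, IV.mul_eq_one_iff, hlo, hlo,
      ← Real.mul_rpow X.lo_nonneg Y.lo_nonneg,
      ← Real.rpow_left_inj (mul_nonneg X.lo_nonneg Y.lo_nonneg) zero_le_one hp.ne', Real.one_rpow]
  mono X Y Z h := by
    refine hO.mono _ _ _ ⟨?_, ?_⟩
    · rw [hlo, hlo]
      exact Real.rpow_le_rpow Y.lo_nonneg h.1 hp.le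
    · rw [hhi, hhi]
      exact Real.rpow_le_rpow Y.hi_nonneg h.2 hp.le
  cont X Y ε hε := by
    have hφ := mooreCont1_of_continuous (Real.continuous_rpow_const hp.le) hlo hhi
    obtain ⟨δ, hδ, h⟩ := hO.cont (φ X) (φ Y) ε hε
    obtain ⟨δ₁, hδ₁, h₁⟩ := hφ X δ hδ
    obtain ⟨δ₂, hδ₂, h₂⟩ := hφ Y δ hδ
    exact ⟨min δ₁ δ₂, lt_min hδ₁ hδ₂, fun X' Y' hX hY =>
      h _ _ (h₁ X' (hX.trans_le (min_le_left _ _))) (h₂ Y' (hY.trans_le (min_le_right _ _)))⟩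

theorem comp_npow (hO : IVOverlap O) {n : ℕ} (hn : n ≠ 0) :
    IVOverlap (fun X Y => O (X.npow n) (Y.npow n)) :=
  hO.comp_rpow (p := n) (by positivity) (fun _ => (Real.rpow_natCast _ _).symm)
    (fun _ => (Real.rpow_natCast _ _).symm)

theorem comp_nroot (hO : IVOverlap O) {n : ℕ} (hn : n ≠ 0) :
    IVOverlap (fun X Y => O (X.nroot n) (Y.nroot n)) :=
  hO.comp_rpow (p := (n : ℝ)⁻¹) (by positivity) (fun _ => rfl) (fun _ => rfl)

/-- Invariance under `n`-th powers would force `O X X = O 0 0 = 0` for `X = [1/2, 1/2]`. -/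
theorem exists_npow_ne (hO : IVOverlap O) {n : ℕ} (hn : 2 ≤ n) :
    ∃ X Y : IV, O (X.npow n) (Y.npow n) ≠ O X Y := by
  by_contra! H
  let X : IV := ⟨1 / 2, 1 / 2, by norm_num, le_rfl, by norm_num⟩
  have hiter (k : ℕ) : O (X.npow (n ^ k)) (X.npow (n ^ k)) = O X X := by
    induction k with
    | zero => rw [pow_zero, show X.npow 1 = X from IV.ext (pow_one _) (pow_one _)]
    | succ k ih => rw [pow_succ, ← IV.npow_npow, H, ih]
  have h00 : O 0 0 = 0 := (hO.zero_iff 0 0).2 ((IV.mul_eq_zero_iff 0 0).2 (mul_zero (0 : ℝ)))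
  have hpos : 0 < (O X X).hi := by
    refine (O X X).hi_nonneg.lt_of_ne' fun h => ?_
    have h0 : O X X = 0 := IV.ext (le_antisymm ((O X X).lo_le_hi.trans h.le) (O X X).lo_nonneg) h
    rw [hO.zero_iff, IV.mul_eq_zero_iff] at h0
    norm_num [X] at h0
  obtain ⟨δ, hδ, h⟩ := hO.cont 0 0 _ hpos
  obtain ⟨k, hk⟩ := exists_pow_lt_of_lt_one hδ (by norm_num : (1 / 2 : ℝ) < 1)
  have hpow : (1 / 2 : ℝ) ^ n ^ k < δ :=
    (pow_le_pow_of_le_one (by norm_num) (by norm_num) (Nat.lt_pow_self hn).le).trans_lt hk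
  have hd : IV.mdist 0 (X.npow (n ^ k)) < δ := by
    have : |(0 : ℝ) - (1 / 2) ^ n ^ k| < δ := by
      rwa [zero_sub, abs_neg, abs_of_nonneg (by positivity)]
    exact max_lt this this
  have hlt := h _ _ hd hd
  rw [hiter, h00] at hlt
  have hhi : |0 - (O X X).hi| < (O X X).hi := (le_max_right _ _).trans_lt hlt
  rw [zero_sub, abs_neg, abs_of_pos hpos] at hhi
  exact hhi.false

theorem exists_ne_nroot (hO : IVOverlap O) {n : ℕ} (hn : 2 ≤ n) :
    ∃ X Y : IV, O X Y ≠ O (X.nroot n) (Y.nroot n) := by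
  obtain ⟨X, Y, h⟩ := hO.exists_npow_ne hn
  refine ⟨X.npow n, Y.npow n, ?_⟩
  rwa [IV.nroot_npow X (by lia), IV.nroot_npow Y (by lia)]

theorem npow_le (hO : IVOverlap O) {n : ℕ} (hn : n ≠ 0) (X Y : IV) :
    O (X.npow n) (Y.npow n) ≤ O X Y :=
  hO.mono₂ (X.npow_le_self hn) (Y.npow_le_self hn)

theorem le_nroot (hO : IVOverlap O) {n : ℕ} (hn : n ≠ 0) (X Y : IV) :
    O X Y ≤ O (X.nroot n) (Y.nroot n) :=
  hO.mono₂ (X.self_le_nroot hn) (Y.self_le_nroot hn)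

end IVOverlap

/-- `O^{1/n}` and `Oⁿ` are interval-valued overlap functions with
`Oⁿ ≤ O ≤ O^{1/n}`, both inequalities strict somewhere; consequently the poset
of interval-valued overlap functions has no least and no greatest element. -/
theorem stmt_3 (O : IV → IV → IV) (hO : IVOverlap O) (n : ℕ) (hn : 2 ≤ n) :
    IVOverlap (fun X Y => O (X.nroot n) (Y.nroot n)) ∧
    IVOverlap (fun X Y => O (X.npow n) (Y.npow n)) ∧
    (∀ X Y : IV, O (X.npow n) (Y.npow n) ≤ O X Y ∧ O X Y ≤ O (X.nroot n) (Y.nroot n)) ∧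
    (∃ X Y : IV, O (X.npow n) (Y.npow n) ≠ O X Y) ∧
    (∃ X Y : IV, O X Y ≠ O (X.nroot n) (Y.nroot n)) ∧
    (¬ ∃ O₀ : IV → IV → IV, IVOverlap O₀ ∧
        ∀ O' : IV → IV → IV, IVOverlap O' → ∀ X Y, O₀ X Y ≤ O' X Y) ∧
    (¬ ∃ O₀ : IV → IV → IV, IVOverlap O₀ ∧
        ∀ O' : IV → IV → IV, IVOverlap O' → ∀ X Y, O' X Y ≤ O₀ X Y) := by
  have hn0 : n ≠ 0 := by lia
  refine ⟨hO.comp_nroot hn0, hO.comp_npow hn0, fun X Y => ⟨hO.npow_le hn0 X Y, hO.le_nroot hn0 X Y⟩,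
    hO.exists_npow_ne hn, hO.exists_ne_nroot hn, ?_, ?_⟩
  · rintro ⟨O₀, h₀, hleast⟩
    obtain ⟨X, Y, hne⟩ := h₀.exists_npow_ne hn
    exact hne (IV.le_antisymm' (h₀.npow_le hn0 X Y) (hleast _ (h₀.comp_npow hn0) X Y))
  · rintro ⟨O₀, h₀, hgreatest⟩
    obtain ⟨X, Y, hne⟩ := h₀.exists_ne_nroot hn
    exact hne (IV.le_antisymm' (h₀.le_nroot hn0 X Y) (hgreatest _ (h₀.comp_nroot hn0) X Y))
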